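/- Let k be an algebraically closed field of characteristic different from 2, and let a ∈ k be such that f_n ≠ 0 for all n ≥ 0, where f_n is computed from the pair (a,-1). Then there is a k-algebra isomorphism between C(a,-1,1) and k_{-1}[x,z] = k⟨x,z⟩/⟨zx + xz⟩. -/

import Mathlib

noncomputable section

open FreeAlgebra

/-- The generator `x` of the free algebra `k⟨x,z⟩`. -/
def Xf (k : Type*) [Field k] : FreeAlgebra k (Fin 2) := FreeAlgebra.ι k 0

/-- The generator `z` of the free algebra `k⟨x,z⟩`. -/
def Zf (k : Type*) [Field k] : FreeAlgebra k (Fin 2) := FreeAlgebra.ι k 1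

/-- The relation defining `C(a,b,c)`: `zx = a·x² + b·xz + c·z²`. -/
def Crel (k : Type*) [Field k] (a b c : k) :
    FreeAlgebra k (Fin 2) → FreeAlgebra k (Fin 2) → Prop := fun m n =>
  m = Zf k * Xf k ∧ n = a • (Xf k) ^ 2 + b • (Xf k * Zf k) + c • (Zf k) ^ 2

/-- The algebra `C(a,b,c) = k⟨x,z⟩/⟨zx - a·x² - b·xz - c·z²⟩`. -/
abbrev Calg (k : Type*) [Field k] (a b c : k) := RingQuot (Crel k a b c)

/-- The relation defining the skew polynomial algebra `k_q[x,z]`: `zx = q·xz`. -/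
def Qrel (k : Type*) [Field k] (q : k) :
    FreeAlgebra k (Fin 2) → FreeAlgebra k (Fin 2) → Prop := fun m n =>
  m = Zf k * Xf k ∧ n = q • (Xf k * Zf k)

/-- The skew polynomial algebra `k_q[x,z] = k⟨x,z⟩/⟨zx - q·xz⟩`. -/
abbrev Qalg (k : Type*) [Field k] (q : k) := RingQuot (Qrel k q)

/-- The pair of sequences `(e_n, f_n)` associated to parameters `a, b`. -/
def efPair {k : Type*} [Field k] (a b : k) : ℕ → k × k
  | 0 => (1, 1)
  | n + 1 => (b * (efPair a b n).1 + (efPair a b n).2,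
              -a * (efPair a b n).1 + (efPair a b n).2)

/-- The sequence `f_n(a,b)`. -/
def fSeq {k : Type*} [Field k] (a b : k) (n : ℕ) : k := (efPair a b n).2

/-- The generators of `k⟨x,z⟩/⟨r⟩` determine an algebra homomorphism out of it. -/
theorem ringQuot_algHom_ext {k A : Type*} [Field k] [Semiring A] [Algebra k A]
    {r : FreeAlgebra k (Fin 2) → FreeAlgebra k (Fin 2) → Prop} {f g : RingQuot r →ₐ[k] A}
    (hx : f (RingQuot.mkAlgHom k r (Xf k)) = g (RingQuot.mkAlgHom k r (Xf k)))
    (hz : f (RingQuot.mkAlgHom k r (Zf k)) = g (RingQuot.mkAlgHom k r (Zf k))) : f = g := by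
  apply RingQuot.ringQuot_ext'
  apply FreeAlgebra.hom_ext
  funext i
  fin_cases i
  · exact hx
  · exact hz

/-- A pair `x, z` with `zx = a·x² + b·xz + c·z²` defines a homomorphism from `C(a,b,c)`. -/
theorem exists_algHom_Calg {k A : Type*} [Field k] [Ring A] [Algebra k A] {a b c : k} (x z : A)
    (h : z * x = a • x ^ 2 + b • (x * z) + c • z ^ 2) :
    ∃ f : Calg k a b c →ₐ[k] A, f (RingQuot.mkAlgHom k (Crel k a b c) (Xf k)) = x ∧
      f (RingQuot.mkAlgHom k (Crel k a b c) (Zf k)) = z := by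
  refine ⟨RingQuot.liftAlgHom k ⟨FreeAlgebra.lift k ![x, z], ?_⟩, ?_, ?_⟩
  · rintro _ _ ⟨rfl, rfl⟩
    simpa [Xf, Zf] using h
  all_goals simp [Xf, Zf]

/-- A pair `x, z` with `zx = q·xz` defines a homomorphism from `k_q[x,z]`. -/
theorem exists_algHom_Qalg {k A : Type*} [Field k] [Ring A] [Algebra k A] {q : k} (x z : A)
    (h : z * x = q • (x * z)) :
    ∃ f : Qalg k q →ₐ[k] A, f (RingQuot.mkAlgHom k (Qrel k q) (Xf k)) = x ∧
      f (RingQuot.mkAlgHom k (Qrel k q) (Zf k)) = z := by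
  refine ⟨RingQuot.liftAlgHom k ⟨FreeAlgebra.lift k ![x, z], ?_⟩, ?_, ?_⟩
  · rintro _ _ ⟨rfl, rfl⟩
    simpa [Xf, Zf] using h
  all_goals simp [Xf, Zf]

theorem Calg_rel {k : Type*} [Field k] (a b c : k) :
    RingQuot.mkAlgHom k (Crel k a b c) (Zf k) * RingQuot.mkAlgHom k (Crel k a b c) (Xf k) =
      a • RingQuot.mkAlgHom k (Crel k a b c) (Xf k) ^ 2 +
        b • (RingQuot.mkAlgHom k (Crel k a b c) (Xf k) *
          RingQuot.mkAlgHom k (Crel k a b c) (Zf k)) +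
        c • RingQuot.mkAlgHom k (Crel k a b c) (Zf k) ^ 2 := by
  simpa only [map_add, map_smul, map_mul, map_pow] using
    RingQuot.mkAlgHom_rel k (s := Crel k a b c) ⟨rfl, rfl⟩

theorem Qalg_rel {k : Type*} [Field k] (q : k) :
    RingQuot.mkAlgHom k (Qrel k q) (Zf k) * RingQuot.mkAlgHom k (Qrel k q) (Xf k) =
      q • (RingQuot.mkAlgHom k (Qrel k q) (Xf k) * RingQuot.mkAlgHom k (Qrel k q) (Zf k)) := by
  simpa only [map_smul, map_mul] using RingQuot.mkAlgHom_rel k (s := Qrel k q) ⟨rfl, rfl⟩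

/-- If `char k ≠ 2` and `f_n(a,-1) ≠ 0` for all `n ≥ 0`, then `C(a,-1,1)` is isomorphic
as a `k`-algebra to `k_{-1}[x,z] = k⟨x,z⟩/⟨zx + xz⟩`. -/
theorem stmt6 {k : Type*} [Field k] [IsAlgClosed k] (hchar : ringChar k ≠ 2) (a : k)
    (hf : ∀ n : ℕ, fSeq a (-1) n ≠ 0) :
    Nonempty (Calg k a (-1) 1 ≃ₐ[k] Qalg k (-1)) := by
  have h2 : (2 : k) ≠ 0 := Ring.two_ne_zero hchar
  obtain ⟨r, hr⟩ := IsAlgClosed.exists_pow_nat_eq (1 - a) (n := 2) two_pos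
  have hr0 : r ≠ 0 := by
    rintro rfl
    apply hf 1
    simp only [fSeq, efPair]
    linear_combination -hr
  obtain rfl : a = 1 - r ^ 2 := by linear_combination hr
  have hQ := Qalg_rel (-1 : k)
  have hC := Calg_rel (1 - r ^ 2) (-1) 1
  set X := RingQuot.mkAlgHom k (Qrel k (-1)) (Xf k) with hX
  set Z := RingQuot.mkAlgHom k (Qrel k (-1)) (Zf k) with hZ
  set x := RingQuot.mkAlgHom k (Crel k (1 - r ^ 2) (-1) 1) (Xf k) with hx
  set z := RingQuot.mkAlgHom k (Crel k (1 - r ^ 2) (-1) 1) (Zf k) with hz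
  obtain ⟨f, hfx, hfz⟩ := exists_algHom_Calg (a := 1 - r ^ 2) (b := -1) (c := 1)
    ((2 * r)⁻¹ • (X - Z)) ((2 : k)⁻¹ • (X + Z) + (2 * r)⁻¹ • (X - Z)) (by
      simp only [mul_add, add_mul, mul_sub, sub_mul, pow_two, smul_mul_assoc, mul_smul_comm, hQ,
        smul_add, smul_sub, smul_smul]
      match_scalars <;> field_simp <;> ring)
  obtain ⟨g, hgx, hgz⟩ := exists_algHom_Qalg (q := (-1 : k)) (z - x + r • x) (z - x - r • x) (by
      simp only [mul_add, add_mul, mul_sub, sub_mul, smul_mul_assoc, mul_smul_comm, hC, pow_two,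
        smul_add, smul_sub, smul_smul]
      match_scalars <;> ring)
  rw [← hx] at hfx
  rw [← hz] at hfz
  rw [← hX] at hgx
  rw [← hZ] at hgz
  refine ⟨AlgEquiv.ofAlgHom f g (ringQuot_algHom_ext ?_ ?_) (ringQuot_algHom_ext ?_ ?_)⟩
  · simp only [← hX, AlgHom.comp_apply, AlgHom.id_apply, hgx, map_add, map_sub, map_smul, hfx, hfz]
    match_scalars <;> field_simp <;> ring
  · simp only [← hZ, AlgHom.comp_apply, AlgHom.id_apply, hgz, map_sub, map_smul, hfx, hfz]
    match_scalars <;> field_simp <;> ring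
  · simp only [← hx, AlgHom.comp_apply, AlgHom.id_apply, hfx, map_sub, map_smul, hgx, hgz]
    match_scalars <;> field_simp <;> ring
  · simp only [← hz, AlgHom.comp_apply, AlgHom.id_apply, hfz, map_add, map_sub, map_smul, hgx, hgz]
    match_scalars <;> field_simp <;> ring
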